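/- Fix an integer a ≥ 2 and an integer m ≥ 1. The number of right 0-pyramids of size m equals (a·m)! / (m! · ((a−1)·m + 1)!), equivalently (1/((a−1)m+1)) · C(a·m, m). -/

import Mathlib

/-- A pyramid made of horizontal pieces of length `a`. -/
def IsPyramid (a : ℕ) (P : Finset (ℤ × ℕ)) : Prop :=
  ((0 : ℤ), (0 : ℕ)) ∈ P ∧
  (∀ p ∈ P, p.2 = 0 → p = ((0 : ℤ), (0 : ℕ))) ∧
  (∀ p ∈ P, ∀ q ∈ P, p.2 = q.2 → p ≠ q → (a : ℤ) ≤ |p.1 - q.1|) ∧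
  (∀ p ∈ P, 1 ≤ p.2 → ∃ q ∈ P, q.2 = p.2 - 1 ∧ |p.1 - q.1| ≤ (a : ℤ) - 1)

/-- A right `0`-pyramid: a pyramid whose bottom piece is a leftmost piece. -/
def IsRightPyramid (a : ℕ) (P : Finset (ℤ × ℕ)) : Prop :=
  IsPyramid a P ∧ ∀ p ∈ P, 0 ≤ p.1

section Heaps

open Finset

variable {α : Type*}

/-- A heap of pieces in layered normal form, where `x ∈ N y` means that a piece at `x` rests on a
piece at `y`, and whose bottom layer is contained in `M`. -/
def IsHeap (N : α → Finset α) (M : Finset α) (P : Finset (α × ℕ)) : Prop :=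
  (∀ x, (x, 0) ∈ P → x ∈ M) ∧
  (∀ x y h, (x, h) ∈ P → (y, h) ∈ P → x ≠ y → x ∉ N y) ∧
  ∀ x h, (x, h + 1) ∈ P → ∃ y, (y, h) ∈ P ∧ x ∈ N y

/-- A set of positions whose pieces do not rest on each other. -/
def IsIndep (N : α → Finset α) (T : Finset α) : Prop :=
  ∀ x ∈ T, ∀ y ∈ T, x ≠ y → x ∉ N y

open scoped Classical in
/-- The independent subsets of `M`. -/
noncomputable def indepSubsets (N : α → Finset α) (M : Finset α) : Finset (Finset α) :=
  M.powerset.filter (IsIndep N)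

lemma mem_indepSubsets {N : α → Finset α} {M T : Finset α} :
    T ∈ indepSubsets N M ↔ T ⊆ M ∧ IsIndep N T := by
  simp [indepSubsets]

/-- The number of heaps of size `k` with bottom layer contained in `M`. The size is an integer so
that no truncated subtraction occurs in recurrences. -/
noncomputable def heapCount (N : α → Finset α) (k : ℤ) (M : Finset α) : ℕ :=
  Nat.card {P : Finset (α × ℕ) // IsHeap N M P ∧ (P.card : ℤ) = k}

/-- Raising a piece by one layer. -/
def raise : α × ℕ ↪ α × ℕ :=
  ⟨fun p => (p.1, p.2 + 1), fun p q h => by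
    simp only [Prod.mk.injEq, add_left_inj] at h
    exact Prod.ext h.1 h.2⟩

lemma raise_apply (p : α × ℕ) : raise p = (p.1, p.2 + 1) := rfl

lemma isHeap_empty_left {N : α → Finset α} {P : Finset (α × ℕ)} :
    IsHeap N ∅ P ↔ P = ∅ := by
  constructor
  · rintro ⟨h1, -, h3⟩
    have key : ∀ h x, (x, h) ∉ P := by
      intro h
      induction h with
      | zero => exact fun x hx => by simpa using h1 x hx
      | succ h ih =>
        intro x hx
        obtain ⟨y, hy, -⟩ := h3 x h hx
        exact ih y hy
    exact eq_empty_of_forall_notMem fun p => key p.2 p.1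
  · rintro rfl
    simp [IsHeap]

lemma heapCount_of_neg (N : α → Finset α) {k : ℤ} (hk : k < 0) (M : Finset α) :
    heapCount N k M = 0 := by
  have : IsEmpty {P : Finset (α × ℕ) // IsHeap N M P ∧ (P.card : ℤ) = k} :=
    ⟨fun P => by have := P.2.2; omega⟩
  exact Nat.card_of_isEmpty

lemma heapCount_zero (N : α → Finset α) (M : Finset α) : heapCount N 0 M = 1 := by
  rw [heapCount, Nat.card_eq_one_iff_unique]
  refine ⟨⟨fun P Q => Subtype.ext ?_⟩, ⟨∅, by simp [IsHeap], by simp⟩⟩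
  have hP := P.2.2
  have hQ := Q.2.2
  simp only [Nat.cast_eq_zero, card_eq_zero] at hP hQ
  rw [hP, hQ]

lemma heapCount_empty_of_ne (N : α → Finset α) {k : ℤ} (hk : k ≠ 0) : heapCount N k ∅ = 0 := by
  have : IsEmpty {P : Finset (α × ℕ) // IsHeap N ∅ P ∧ (P.card : ℤ) = k} := by
    refine ⟨fun P => hk ?_⟩
    rw [← P.2.2, isHeap_empty_left.1 P.2.1, card_empty, Nat.cast_zero]
  exact Nat.card_of_isEmpty

variable [DecidableEq α]

/-- The heap obtained by putting `P` on top of the layer `T`. -/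
def stack (T : Finset α) (P : Finset (α × ℕ)) : Finset (α × ℕ) :=
  T ×ˢ {0} ∪ P.map raise

lemma mem_stack_zero {T : Finset α} {P : Finset (α × ℕ)} {x : α} :
    (x, 0) ∈ stack T P ↔ x ∈ T := by
  simp [stack, raise_apply]

lemma mem_stack_succ {T : Finset α} {P : Finset (α × ℕ)} {x : α} {h : ℕ} :
    (x, h + 1) ∈ stack T P ↔ (x, h) ∈ P := by
  simp [stack, raise_apply]

lemma card_stack (T : Finset α) (P : Finset (α × ℕ)) : (stack T P).card = T.card + P.card := by
  rw [stack, card_union_of_disjoint, card_map, card_product, card_singleton, mul_one]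
  rw [disjoint_left]
  rintro ⟨x, h⟩ h1 h2
  simp only [mem_product, mem_singleton] at h1
  obtain ⟨-, rfl⟩ := h1
  simp [raise_apply] at h2

lemma exists_stack_eq (Q : Finset (α × ℕ)) : ∃ T P, stack T P = Q := by
  refine ⟨(Q.filter (·.2 = 0)).image Prod.fst, Q.preimage raise raise.injective.injOn, ?_⟩
  ext ⟨x, h⟩
  cases h with
  | zero => simp [mem_stack_zero]
  | succ h => simp [mem_stack_succ, raise_apply]

lemma stack_inj {T T' : Finset α} {P P' : Finset (α × ℕ)} (h : stack T P = stack T' P') :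
    T = T' ∧ P = P' := by
  constructor
  · ext x
    rw [← mem_stack_zero (P := P), h, mem_stack_zero]
  · ext ⟨x, n⟩
    rw [← mem_stack_succ (T := T), h, mem_stack_succ]

lemma isHeap_stack {N : α → Finset α} {M T : Finset α} {P : Finset (α × ℕ)} :
    IsHeap N M (stack T P) ↔ T ∈ indepSubsets N M ∧ IsHeap N (T.biUnion N) P := by
  simp only [IsHeap, mem_indepSubsets, IsIndep, mem_biUnion]
  constructor
  · rintro ⟨h1, h2, h3⟩
    refine ⟨⟨fun x hx => h1 x (mem_stack_zero.2 hx), fun x hx y hy => h2 x y 0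
      (mem_stack_zero.2 hx) (mem_stack_zero.2 hy)⟩, fun x hx => ?_, fun x y h hx hy =>
      h2 x y (h + 1) (mem_stack_succ.2 hx) (mem_stack_succ.2 hy), fun x h hx => ?_⟩
    · simpa only [mem_stack_zero] using h3 x 0 (mem_stack_succ.2 hx)
    · simpa only [mem_stack_succ] using h3 x (h + 1) (mem_stack_succ.2 hx)
  · rintro ⟨⟨h1, h2⟩, h3, h4, h5⟩
    refine ⟨fun x hx => h1 (mem_stack_zero.1 hx), fun x y h => ?_, fun x h => ?_⟩
    · cases h with
      | zero => simpa only [mem_stack_zero] using fun hx hy => h2 x hx y hy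
      | succ h => simpa only [mem_stack_succ] using h4 x y h
    · cases h with
      | zero => simpa only [mem_stack_zero, mem_stack_succ] using h3 x
      | succ h => simpa only [mem_stack_succ] using h5 x h

/-- Removing the bottom layer of a heap. -/
noncomputable def heapEquiv (N : α → Finset α) (k : ℤ) (M : Finset α) :
    (Σ T : indepSubsets N M, {P : Finset (α × ℕ) //
      IsHeap N (T.1.biUnion N) P ∧ (P.card : ℤ) = k - T.1.card}) ≃
    {P : Finset (α × ℕ) // IsHeap N M P ∧ (P.card : ℤ) = k} :=
  Equiv.ofBijective
    (fun p => ⟨stack p.1.1 p.2.1, isHeap_stack.2 ⟨p.1.2, p.2.2.1⟩, by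
      have := p.2.2.2
      rw [card_stack]
      push_cast
      omega⟩) <| by
    constructor
    · rintro ⟨⟨T, hT⟩, P, hP⟩ ⟨⟨T', hT'⟩, P', hP'⟩ h
      obtain ⟨rfl, rfl⟩ := stack_inj (Subtype.ext_iff.1 h)
      rfl
    · rintro ⟨Q, hQ, hk⟩
      obtain ⟨T, P, rfl⟩ := exists_stack_eq Q
      obtain ⟨hT, hP⟩ := isHeap_stack.1 hQ
      refine ⟨⟨⟨T, hT⟩, P, hP, ?_⟩, rfl⟩
      rw [card_stack] at hk
      push_cast at hk
      dsimp only
      omega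

lemma finite_heaps (N : α → Finset α) (k : ℤ) (M : Finset α) :
    Finite {P : Finset (α × ℕ) // IsHeap N M P ∧ (P.card : ℤ) = k} := by
  classical
  obtain ⟨n, hn⟩ : ∃ n : ℕ, k < n := ⟨(k + 1).toNat, by omega⟩
  induction n generalizing k M with
  | zero =>
    have : IsEmpty {P : Finset (α × ℕ) // IsHeap N M P ∧ (P.card : ℤ) = k} :=
      ⟨fun P => by have := P.2.2; omega⟩
    infer_instance
  | succ n ih =>
    have : ∀ T : indepSubsets N M, Finite {P : Finset (α × ℕ) //
        IsHeap N (T.1.biUnion N) P ∧ (P.card : ℤ) = k - T.1.card} := by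
      rintro ⟨T, hT⟩
      rcases T.eq_empty_or_nonempty with rfl | hne
      · simp only [biUnion_empty, isHeap_empty_left]
        exact Set.Finite.subset (Set.finite_singleton ∅) fun P hP => hP.1
      · have := hne.card_pos
        exact ih _ _ (by push_cast at hn ⊢; omega)
    exact Finite.of_equiv _ (heapEquiv N k M)

lemma heapCount_eq_sum (N : α → Finset α) (k : ℤ) (M : Finset α) :
    heapCount N k M = ∑ T ∈ indepSubsets N M, heapCount N (k - T.card) (T.biUnion N) := by
  have := fun T : indepSubsets N M => finite_heaps N (k - T.1.card) (T.1.biUnion N)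
  rw [heapCount, ← Nat.card_congr (heapEquiv N k M), Nat.card_sigma,
    ← sum_coe_sort (indepSubsets N M)]
  rfl

variable {N : α → Finset α}

lemma sum_indepSubsets_insert (hN : ∀ x y, x ∈ N y ↔ y ∈ N x) {A : Finset α} {b : α} (hb : b ∉ A)
    (f : Finset α → ℕ) :
    ∑ T ∈ indepSubsets N (insert b A), f T =
      ∑ T ∈ indepSubsets N A, f T + ∑ T ∈ indepSubsets N (A \ N b), f (insert b T) := by
  rw [indepSubsets, sum_filter, sum_powerset_insert hb, ← sum_filter, ← sum_filter]
  congr 1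
  refine sum_congr ?_ fun _ _ => rfl
  ext T
  simp only [mem_filter, mem_powerset, mem_indepSubsets]
  simp only [IsIndep, mem_insert, subset_sdiff, disjoint_left]
  constructor
  · rintro ⟨hT, h⟩
    exact ⟨⟨hT, fun x hx => h x (.inr hx) b (.inl rfl) fun e => hb (e ▸ hT hx)⟩,
      fun x hx y hy => h x (.inr hx) y (.inr hy)⟩
  · rintro ⟨⟨hT, h1⟩, h2⟩
    refine ⟨hT, ?_⟩
    rintro x (rfl | hx) y (rfl | hy) hne
    · exact absurd rfl hne
    · rw [hN]; exact h1 hy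
    · exact h1 hx
    · exact h2 x hx y hy hne

lemma sum_indepSubsets_union (hN : ∀ x y, x ∈ N y ↔ y ∈ N x) (A B : Finset α)
    (f : Finset α → ℕ) :
    ∑ T ∈ indepSubsets N (A ∪ B), f T =
      ∑ T ∈ indepSubsets N (A \ B), ∑ S ∈ indepSubsets N (B \ T.biUnion N), f (T ∪ S) := by
  rw [sum_sigma']
  refine sum_bij' (fun T _ => ⟨T \ B, T ∩ B⟩) (fun p _ => p.1 ∪ p.2) ?_ ?_ ?_ ?_ ?_
  · intro T hT
    simp only [mem_indepSubsets, IsIndep, mem_sigma] at hT ⊢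
    obtain ⟨h1, h2⟩ := hT
    refine ⟨⟨fun x hx => ?_, fun x hx y hy => ?_⟩, fun x hx => ?_, fun x hx y hy => ?_⟩
    · have := @h1 x
      simp only [mem_sdiff, mem_union] at *
      tauto
    · exact h2 x (mem_sdiff.1 hx).1 y (mem_sdiff.1 hy).1
    · simp only [mem_sdiff, mem_biUnion, mem_inter] at *
      refine ⟨hx.2, ?_⟩
      rintro ⟨y, hy, hxy⟩
      exact h2 x hx.1 y hy.1 (fun e => hy.2 (e ▸ hx.2)) hxy
    · exact h2 x (mem_inter.1 hx).1 y (mem_inter.1 hy).1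
  · rintro ⟨T, S⟩ hp
    simp only [mem_indepSubsets, IsIndep, mem_sigma] at hp ⊢
    obtain ⟨⟨h1, h2⟩, h3, h4⟩ := hp
    have h5 : ∀ x ∈ S, ∀ y ∈ T, x ∉ N y := fun x hx y hy hxy =>
      (mem_sdiff.1 (h3 hx)).2 (mem_biUnion.2 ⟨y, hy, hxy⟩)
    refine ⟨union_subset_union (h1.trans sdiff_subset) (h3.trans sdiff_subset), ?_⟩
    intro x hx y hy hne
    rcases mem_union.1 hx with hx | hx <;> rcases mem_union.1 hy with hy | hy
    · exact h2 x hx y hy hne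
    · rw [hN]; exact h5 y hy x hx
    · exact h5 x hx y hy
    · exact h4 x hx y hy hne
  · intro T _
    exact sdiff_union_inter T B
  · rintro ⟨T, S⟩ hp
    simp only [mem_indepSubsets, mem_sigma, subset_sdiff] at hp
    obtain ⟨⟨⟨-, h1⟩, -⟩, ⟨h2, -⟩, -⟩ := hp
    have e1 : (T ∪ S) \ B = T := by
      rw [union_sdiff_distrib, sdiff_eq_self_of_disjoint h1, sdiff_eq_empty_iff_subset.2 h2,
        union_empty]
    have e2 : (T ∪ S) ∩ B = S := by
      rw [union_inter_distrib_right, disjoint_iff_inter_eq_empty.1 h1, empty_union,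
        inter_eq_left.2 h2]
    simp only [e1, e2]
  · intro T _
    simp only [sdiff_union_inter]

/-- If adding one position to the bottom is governed by the one-step recurrence up to size `n`,
then so is adding a set of positions. -/
lemma heapCount_union_of_insert (hN : ∀ x y, x ∈ N y ↔ y ∈ N x) {n : ℤ}
    (H : ∀ k < n, ∀ (A : Finset α) (b : α), b ∉ A →
      heapCount N k (insert b A) = heapCount N k A + heapCount N (k - 1) (A ∪ N b))
    (B A : Finset α) (k : ℤ) (hk : k < n) :
    heapCount N k (A ∪ B) =
      ∑ S ∈ indepSubsets N (B \ A), heapCount N (k - S.card) (A ∪ S.biUnion N) := by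
  induction B using Finset.induction_on generalizing A k with
  | empty => simp [indepSubsets, IsIndep, filter_singleton]
  | insert b B hb ih =>
    by_cases hA : b ∈ A
    · rw [insert_sdiff_of_mem _ hA, ← ih A k hk, union_insert, insert_eq_of_mem (by simp [hA])]
    · rw [insert_sdiff_of_notMem _ hA, sum_indepSubsets_insert hN (by simp [hb]), ← ih A k hk,
        union_insert, H k hk _ _ (by simp [hA, hb]), union_right_comm,
        ih (A ∪ N b) (k - 1) (by omega), sdiff_sdiff_left, sup_eq_union]
      refine congrArg _ (sum_congr rfl fun S hS => ?_)
      have hbS : b ∉ S := fun h => hb (mem_sdiff.1 ((mem_indepSubsets.1 hS).1 h)).1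
      rw [card_insert_of_notMem hbS, biUnion_insert, union_assoc]
      congr 1
      push_cast
      ring

theorem heapCount_insert (hN : ∀ x y, x ∈ N y ↔ y ∈ N x) (k : ℤ) (A : Finset α) (b : α)
    (hb : b ∉ A) :
    heapCount N k (insert b A) = heapCount N k A + heapCount N (k - 1) (A ∪ N b) := by
  obtain ⟨n, hn⟩ : ∃ n : ℕ, k < n := ⟨(k + 1).toNat, by omega⟩
  induction n generalizing k A b with
  | zero =>
    have hk : k < 0 := by simpa using hn
    rw [heapCount_of_neg N hk, heapCount_of_neg N hk, heapCount_of_neg N (by omega)]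
  | succ n ih =>
    rw [heapCount_eq_sum, sum_indepSubsets_insert hN hb, ← heapCount_eq_sum,
      heapCount_eq_sum N (k - 1), sum_indepSubsets_union hN]
    refine congrArg _ (sum_congr rfl fun T hT => ?_)
    have hbT : b ∉ T := fun h => hb (mem_sdiff.1 ((mem_indepSubsets.1 hT).1 h)).1
    have hTb : Disjoint T (N b) := (subset_sdiff.1 (mem_indepSubsets.1 hT).1).2
    rw [card_insert_of_notMem hbT, biUnion_insert, union_comm,
      heapCount_union_of_insert hN (fun k hk A b hb => ih k A b hb hk) _ _ _
        (by push_cast at hn ⊢; omega)]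
    refine sum_congr rfl fun S hS => ?_
    have hS : S ⊆ N b := (mem_indepSubsets.1 hS).1.trans sdiff_subset
    rw [card_union_of_disjoint (hTb.mono_right hS), union_biUnion]
    congr 1
    push_cast
    ring

end Heaps

section Pieces

open Finset

/-- The nonnegative positions at which a piece of length `a` overlaps a piece at `y`. -/
def overlapping (a y : ℕ) : Finset ℕ :=
  (range (y + a)).filter (y < · + a)

lemma mem_overlapping {a x y : ℕ} : x ∈ overlapping a y ↔ x < y + a ∧ y < x + a := by
  simp [overlapping]

lemma heapCount_range_succ {a : ℕ} (ha : 1 ≤ a) (k : ℤ) (r : ℕ) :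
    heapCount (overlapping a) k (range (r + 1)) =
      heapCount (overlapping a) k (range r) + heapCount (overlapping a) (k - 1) (range (r + a)) := by
  rw [range_add_one, heapCount_insert (fun x y => by simp only [mem_overlapping]; tauto) k _ _
    (by simp)]
  congr 2
  ext x
  simp only [mem_union, mem_range, mem_overlapping]
  omega

/-- The heaps of `m` pieces of length `b + 1` with bottom layer in `{0, …, r}` are counted by the
Raney numbers. -/
theorem heapCount_range_mul (b m r : ℕ) :
    heapCount (overlapping (b + 1)) m (range (r + 1)) *
      (m.factorial * (b * m + r + 1).factorial) = (r + 1) * ((b + 1) * m + r).factorial := by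
  induction m generalizing r with
  | zero =>
    simp [heapCount_zero, Nat.factorial_succ]
  | succ m ih =>
    have step : ∀ r, heapCount (overlapping (b + 1)) (m + 1 : ℕ) (range (r + 1)) =
        heapCount (overlapping (b + 1)) (m + 1 : ℕ) (range r) +
          heapCount (overlapping (b + 1)) m (range (r + b + 1)) := fun r => by
      rw [heapCount_range_succ (by omega)]
      push_cast
      simp only [add_sub_cancel_right, add_assoc]
    have key := fun r => ih (r + b)
    induction r with
    | zero =>
      have h0 : heapCount (overlapping (b + 1)) (m + 1 : ℕ) (range 0) = 0 :=
        heapCount_empty_of_ne _ (by push_cast; omega)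
      have k0 := key 0
      rw [step, h0]
      rw [show b * m + (0 + b) + 1 = b * (m + 1) + 0 + 1 by ring,
        show (b + 1) * m + (0 + b) = (b + 1) * m + b by ring] at k0
      rw [show (b + 1) * (m + 1) + 0 = (b + 1) * m + b + 1 by ring, Nat.factorial_succ m,
        Nat.factorial_succ ((b + 1) * m + b)]
      linear_combination (m + 1) * k0
    | succ r ihr =>
      have k1 := key (r + 1)
      rw [step]
      rw [show b * m + (r + 1 + b) + 1 = b * (m + 1) + r + 1 + 1 by ring,
        Nat.factorial_succ (b * (m + 1) + r + 1),
        show (b + 1) * m + (r + 1 + b) = (b + 1) * (m + 1) + r by ring] at k1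
      rw [show b * (m + 1) + (r + 1) + 1 = b * (m + 1) + r + 1 + 1 by ring,
        Nat.factorial_succ (b * (m + 1) + r + 1),
        show (b + 1) * (m + 1) + (r + 1) = (b + 1) * (m + 1) + r + 1 by ring,
        Nat.factorial_succ ((b + 1) * (m + 1) + r)]
      rw [Nat.factorial_succ m] at ihr ⊢
      linear_combination (m + 1) * k1 + (b * (m + 1) + r + 1 + 1) * ihr

/-- Viewing a natural position as an integer position. -/
def castPosition : ℕ × ℕ ↪ ℤ × ℕ :=
  Nat.castEmbedding.prodMap (Function.Embedding.refl ℕ)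

lemma mem_map_castPosition {Q : Finset (ℕ × ℕ)} {x h : ℕ} :
    ((x : ℤ), h) ∈ Q.map castPosition ↔ (x, h) ∈ Q := by
  simp [castPosition]

lemma isRightPyramid_map {a m : ℕ} (hm : 1 ≤ m) {Q : Finset (ℕ × ℕ)} (hQ : Q.card = m) :
    IsRightPyramid a (Q.map castPosition) ↔ IsHeap (overlapping a) (range 1) Q := by
  have hforall : ∀ p : ℤ × ℕ → Prop,
      (∀ q ∈ Q.map castPosition, p q) ↔ ∀ x h : ℕ, (x, h) ∈ Q → p (x, h) := by
    refine fun p => ⟨fun H x h hx => H _ (mem_map_castPosition.2 hx), fun H q hq => ?_⟩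
    obtain ⟨⟨x, h⟩, hx, rfl⟩ := mem_map.1 hq
    exact H x h hx
  have hexists : ∀ p : ℤ × ℕ → Prop,
      (∃ q ∈ Q.map castPosition, p q) ↔ ∃ x h : ℕ, (x, h) ∈ Q ∧ p (x, h) := by
    refine fun p => ⟨?_, fun ⟨x, h, hx, hp⟩ => ⟨_, mem_map_castPosition.2 hx, hp⟩⟩
    rintro ⟨q, hq, hp⟩
    obtain ⟨⟨x, h⟩, hx, rfl⟩ := mem_map.1 hq
    exact ⟨x, h, hx, hp⟩
  have h00 : ((0 : ℤ), 0) ∈ Q.map castPosition ↔ (0, 0) ∈ Q := mem_map_castPosition (x := 0)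
  simp only [IsRightPyramid, IsPyramid, hforall, hexists, h00, IsHeap, mem_overlapping, mem_range]
  constructor
  · rintro ⟨⟨-, h2, h3, h4⟩, -⟩
    refine ⟨fun x hx => ?_, fun x y h hx hy hne => ?_, fun x h hx => ?_⟩
    · have := congrArg Prod.fst (h2 x 0 hx rfl)
      simp only [Nat.cast_eq_zero] at this
      omega
    · have := h3 x h hx y h hy rfl (by simpa using hne)
      rw [le_abs] at this
      omega
    · obtain ⟨y, h', hy, e, hxy⟩ := h4 x (h + 1) hx (by simp)
      simp only [add_tsub_cancel_right] at e hxy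
      subst e
      rw [abs_le] at hxy
      exact ⟨y, hy, by omega⟩
  · rintro ⟨h1, h2, h3⟩
    refine ⟨⟨?_, fun x h hx h0 => ?_, fun x h hx y h' hy e hne => ?_, fun x h hx h0 => ?_⟩,
      fun x h _ => by simp⟩
    · have hbot : ∀ h x, (x, h) ∈ Q → ∃ y, (y, 0) ∈ Q := by
        intro h
        induction h with
        | zero => exact fun x hx => ⟨x, hx⟩
        | succ h ih =>
          intro x hx
          obtain ⟨y, hy, -⟩ := h3 x h hx
          exact ih y hy
      obtain ⟨⟨x, h⟩, hx⟩ := card_pos.1 (hQ ▸ hm : 0 < Q.card)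
      obtain ⟨y, hy⟩ := hbot h x hx
      obtain rfl : y = 0 := by have := h1 y hy; omega
      exact hy
    · subst h0
      obtain rfl : x = 0 := by have := h1 x hx; omega
      rfl
    · subst e
      have := h2 x y h hx hy (by simpa using hne)
      rw [le_abs]
      omega
    · obtain ⟨n, rfl⟩ : ∃ n, h = n + 1 := ⟨h - 1, by omega⟩
      obtain ⟨y, hy, hxy⟩ := h3 x n hx
      refine ⟨y, n, hy, rfl, ?_⟩
      rw [abs_le]
      omega

lemma card_rightPyramid {a m : ℕ} (hm : 1 ≤ m) :
    Nat.card {P : Finset (ℤ × ℕ) // IsRightPyramid a P ∧ P.card = m} =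
      heapCount (overlapping a) m (range 1) := by
  symm
  refine Nat.card_congr (Equiv.ofBijective (fun Q => ⟨Q.1.map castPosition,
    (isRightPyramid_map hm (Nat.cast_injective Q.2.2)).2 Q.2.1,
    (card_map _).trans (Nat.cast_injective Q.2.2)⟩) ⟨fun Q Q' h => ?_, ?_⟩)
  · exact Subtype.ext (map_injective _ (Subtype.ext_iff.1 h))
  · rintro ⟨P, hP, hPm⟩
    obtain ⟨Q, rfl⟩ : ∃ Q : Finset (ℕ × ℕ), Q.map castPosition = P := by
      refine ⟨P.preimage castPosition castPosition.injective.injOn, ?_⟩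
      ext ⟨x, h⟩
      simp only [mem_map, mem_preimage]
      constructor
      · rintro ⟨q, hq, e⟩
        exact e ▸ hq
      · intro hx
        have hx0 : 0 ≤ x := hP.2 _ hx
        lift x to ℕ using hx0
        exact ⟨(x, h), hx, rfl⟩
    rw [card_map] at hPm
    exact ⟨⟨Q, (isRightPyramid_map hm hPm).1 hP, by rw [hPm]⟩, rfl⟩

end Pieces

/-- The number of right `0`-pyramids of size `m` equals the Fuss–Catalan number
`(a·m)! / (m! · ((a−1)·m + 1)!)`. -/
theorem right_pyramid_count (a m : ℕ) (ha : 2 ≤ a) (hm : 1 ≤ m) :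
    (Nat.card {P : Finset (ℤ × ℕ) // IsRightPyramid a P ∧ P.card = m} : ℚ) =
      ((a * m).factorial : ℚ) /
        ((m.factorial : ℚ) * (((a - 1) * m + 1).factorial : ℚ)) := by
  rw [card_rightPyramid hm, eq_div_iff (by positivity)]
  obtain ⟨b, rfl⟩ : ∃ b, a = b + 1 := ⟨a - 1, by omega⟩
  have h := heapCount_range_mul b m 0
  simp only [zero_add, add_zero, one_mul] at h
  rw [Nat.add_sub_cancel]
  exact_mod_cast h
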